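/- Let X, Z ∈ ℝ^d be random vectors with E[|X_i|^{q+d}] < C_q and E[|Z_i|^{q+d}] < C_q for all i = 1,…,d and some q > 0. Then |E[∏_{i=1}^d X_i] − E[∏_{i=1}^d Z_i]| ≤ 2 √d (4√d · C_q)^{(d−1)/(q+d−1)} · d_1(X,Z)^{q/(q+d−1)}. -/

import Mathlib

open MeasureTheory ProbabilityTheory Finset

noncomputable section

/-- `ζ` is `1`-Lipschitz with respect to the Euclidean norm on `ι → ℝ`. -/
def LipschitzEuclid {ι : Type*} [Fintype ι] (ζ : (ι → ℝ) → ℝ) : Prop :=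
  ∀ f g : ι → ℝ, |ζ f - ζ g| ≤ Real.sqrt (∑ i, (f i - g i) ^ 2)

/-- The Wasserstein-1 distance between the laws of `X` and `Y`, as a supremum over
`1`-Lipschitz (w.r.t. the Euclidean norm) test functions. -/
def d1 {Ω : Type*} [MeasurableSpace Ω] {ι : Type*} [Fintype ι]
    (μ : Measure Ω) (X Y : Ω → ι → ℝ) : ℝ :=
  sSup {r | ∃ ζ : (ι → ℝ) → ℝ, LipschitzEuclid ζ ∧
    r = |(∫ ω, ζ (X ω) ∂μ) - ∫ ω, ζ (Y ω) ∂μ|}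

/-- First partial derivative of `η` at `x` in coordinate `i`. -/
def pd1 {ι : Type*} [Fintype ι] [DecidableEq ι] (η : (ι → ℝ) → ℝ) (x : ι → ℝ) (i : ι) : ℝ :=
  iteratedFDeriv ℝ 1 η x fun _ => Pi.single i 1

/-- Second partial derivative of `η` at `x` in coordinates `i, j`. -/
def pd2 {ι : Type*} [Fintype ι] [DecidableEq ι] (η : (ι → ℝ) → ℝ) (x : ι → ℝ) (i j : ι) : ℝ :=
  iteratedFDeriv ℝ 2 η x ![Pi.single i 1, Pi.single j 1]

/-- Third partial derivative of `η` at `x` in coordinates `i, j, k`. -/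
def pd3 {ι : Type*} [Fintype ι] [DecidableEq ι] (η : (ι → ℝ) → ℝ) (x : ι → ℝ) (i j k : ι) : ℝ :=
  iteratedFDeriv ℝ 3 η x ![Pi.single i 1, Pi.single j 1, Pi.single k 1]

/-- Test functions for the `d₃` metric: three times differentiable with all first, second and
third partial derivatives bounded by one. -/
def TestD3 {ι : Type*} [Fintype ι] [DecidableEq ι] (ζ : (ι → ℝ) → ℝ) : Prop :=
  ContDiff ℝ 3 ζ ∧ (∀ x i, |pd1 ζ x i| ≤ 1) ∧ (∀ x i j, |pd2 ζ x i j| ≤ 1) ∧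
    (∀ x i j k, |pd3 ζ x i j k| ≤ 1)

/-- The `d₃` integral probability metric between the laws of `X` and `Y`. -/
def d3 {Ω : Type*} [MeasurableSpace Ω] {ι : Type*} [Fintype ι] [DecidableEq ι]
    (μ : Measure Ω) (X Y : Ω → ι → ℝ) : ℝ :=
  sSup {r | ∃ ζ : (ι → ℝ) → ℝ, TestD3 ζ ∧
    r = |(∫ ω, ζ (X ω) ∂μ) - ∫ ω, ζ (Y ω) ∂μ|}


/-- Truncation of a real number to `[-M, M]`. -/
def clip (M x : ℝ) : ℝ := max (-M) (min x M)

lemma abs_clip_le {M : ℝ} (hM : 0 ≤ M) (x : ℝ) : |clip M x| ≤ M :=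
  abs_le.2 ⟨le_max_left _ _, max_le (by linarith) (min_le_right _ _)⟩

lemma abs_clip_le_abs {M : ℝ} (hM : 0 ≤ M) (x : ℝ) : |clip M x| ≤ |x| := by
  unfold clip
  grind

lemma clip_eq_self {M x : ℝ} (h : |x| ≤ M) : clip M x = x := by
  rw [clip, min_eq_left (abs_le.1 h).2, max_eq_right (abs_le.1 h).1]

lemma abs_clip_sub_clip_le (M x y : ℝ) : |clip M x - clip M y| ≤ |x - y| := by
  unfold clip
  grind

lemma continuous_clip (M : ℝ) : Continuous (clip M) := by
  unfold clip
  fun_prop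

lemma abs_prod_le_pow_card {ι : Type*} (s : Finset ι) {M : ℝ} (a : ι → ℝ)
    (ha : ∀ i, |a i| ≤ M) : |∏ i ∈ s, a i| ≤ M ^ #s := by
  rw [abs_prod, ← prod_const]
  exact prod_le_prod (fun i _ => abs_nonneg _) fun i _ => ha i

lemma mul_abs_prod_sub_prod_le {ι : Type*} (s : Finset ι) {M : ℝ} (hM : 0 ≤ M) (a b : ι → ℝ)
    (ha : ∀ i, |a i| ≤ M) (hb : ∀ i, |b i| ≤ M) :
    M * |∏ i ∈ s, a i - ∏ i ∈ s, b i| ≤ M ^ #s * ∑ i ∈ s, |a i - b i| := by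
  classical
  induction s using Finset.induction_on with
  | empty => simp
  | insert j s hj ih =>
    rw [prod_insert hj, prod_insert hj, sum_insert hj, card_insert_of_notMem hj, pow_succ]
    have hp := abs_prod_le_pow_card s b hb
    have key : |a j * ∏ i ∈ s, a i - b j * ∏ i ∈ s, b i| ≤
        M * |∏ i ∈ s, a i - ∏ i ∈ s, b i| + |a j - b j| * M ^ #s := by
      have : a j * ∏ i ∈ s, a i - b j * ∏ i ∈ s, b i =
          a j * (∏ i ∈ s, a i - ∏ i ∈ s, b i) + (a j - b j) * ∏ i ∈ s, b i := by ring
      rw [this]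
      refine (abs_add_le _ _).trans ?_
      rw [abs_mul, abs_mul]
      gcongr
      exact ha j
    calc _ ≤ M * (M * |∏ i ∈ s, a i - ∏ i ∈ s, b i| + |a j - b j| * M ^ #s) := by gcongr
      _ ≤ M * (M ^ #s * ∑ i ∈ s, |a i - b i| + |a j - b j| * M ^ #s) := by gcongr
      _ = _ := by ring

lemma sum_abs_le_sqrt_card_mul {ι : Type*} [Fintype ι] (a : ι → ℝ) :
    ∑ i, |a i| ≤ Real.sqrt (Fintype.card ι) * Real.sqrt (∑ i, a i ^ 2) := by
  rw [← Real.sqrt_mul (by positivity)]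
  refine Real.le_sqrt_of_sq_le ?_
  simpa using sq_sum_le_card_mul_sum_sq (s := univ) (f := fun i => |a i|)

lemma sqrt_sum_sq_le_sum_abs {ι : Type*} [Fintype ι] (a : ι → ℝ) :
    Real.sqrt (∑ i, a i ^ 2) ≤ ∑ i, |a i| := by
  refine Real.sqrt_le_iff.2 ⟨by positivity, ?_⟩
  simpa using sum_sq_le_sq_sum_of_nonneg (s := univ) (f := fun i => |a i|)
    (fun i _ => abs_nonneg _)

lemma abs_prod_clip_sub_le {d : ℕ} {M : ℝ} (hM : 0 < M) (x y : Fin d → ℝ) :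
    |∏ i, clip M (x i) - ∏ i, clip M (y i)| ≤
      Real.sqrt d * M ^ ((d : ℝ) - 1) * Real.sqrt (∑ i, (x i - y i) ^ 2) := by
  have h := mul_abs_prod_sub_prod_le univ hM.le (fun i => clip M (x i)) (fun i => clip M (y i))
    (fun i => abs_clip_le hM.le _) (fun i => abs_clip_le hM.le _)
  have h2 : ∑ i, |clip M (x i) - clip M (y i)| ≤
      Real.sqrt d * Real.sqrt (∑ i, (x i - y i) ^ 2) :=
    (sum_le_sum fun i _ => abs_clip_sub_clip_le M (x i) (y i)).trans
      (by simpa using sum_abs_le_sqrt_card_mul fun i => x i - y i)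
  rw [card_univ, Fintype.card_fin] at h
  rw [Real.rpow_sub_one hM.ne', Real.rpow_natCast]
  rw [← mul_le_mul_iff_right₀ hM]
  calc _ ≤ _ := h
    _ ≤ M ^ d * (Real.sqrt d * Real.sqrt (∑ i, (x i - y i) ^ 2)) := by gcongr
    _ = _ := by field_simp

/-- Truncating the coordinates at level `M` changes a product by at most a tail term. -/
lemma abs_prod_sub_prod_clip_le {d : ℕ} {q M : ℝ} (hq : 0 < q) (hM : 0 < M) (x : Fin d → ℝ) :
    |∏ i, x i - ∏ i, clip M (x i)| ≤ 2 * M ^ (-q) * ∑ i, |x i| ^ (q + d) := by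
  by_cases h : ∀ i, |x i| ≤ M
  · have : ∏ i, clip M (x i) = ∏ i, x i := prod_congr rfl fun i _ => clip_eq_self (h i)
    rw [this, sub_self, abs_zero]
    positivity
  · push Not at h
    obtain ⟨j, hj⟩ := h
    obtain ⟨k, -, hk⟩ := exists_max_image univ (fun i => |x i|) ⟨j, mem_univ j⟩
    have hMk : M < |x k| := hj.trans_le (hk j (mem_univ j))
    have hk0 : 0 < |x k| := hM.trans hMk
    have h1 : |∏ i, x i| ≤ |x k| ^ d := by
      simpa using abs_prod_le_pow_card univ x fun i => hk i (mem_univ i)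
    have h2 : |∏ i, clip M (x i)| ≤ |x k| ^ d := by
      simpa using abs_prod_le_pow_card univ (fun i => clip M (x i))
        fun i => (abs_clip_le_abs hM.le _).trans (hk i (mem_univ i))
    have h3 : |x k| ^ d ≤ M ^ (-q) * |x k| ^ (q + d) := by
      rw [Real.rpow_add hk0, Real.rpow_natCast, Real.rpow_neg hM.le, ← mul_assoc]
      refine le_mul_of_one_le_left (by positivity) ?_
      rw [inv_mul_eq_div, one_le_div (by positivity)]
      gcongr
    have h4 : |x k| ^ (q + d) ≤ ∑ i, |x i| ^ (q + d) :=
      single_le_sum (f := fun i => |x i| ^ (q + d)) (fun i _ => by positivity) (mem_univ k)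
    calc _ ≤ |∏ i, x i| + |∏ i, clip M (x i)| := abs_sub _ _
      _ ≤ 2 * (M ^ (-q) * |x k| ^ (q + d)) := by linarith
      _ ≤ 2 * (M ^ (-q) * ∑ i, |x i| ^ (q + d)) := by gcongr
      _ = _ := by ring

section LipschitzEuclid

variable {Ω ι : Type*} [MeasurableSpace Ω] [Fintype ι] {μ : Measure Ω} {ζ : (ι → ℝ) → ℝ}

lemma LipschitzEuclid.continuous (h : LipschitzEuclid ζ) : Continuous ζ := by
  refine continuous_iff_continuousAt.2 fun y => ?_
  rw [ContinuousAt, tendsto_iff_dist_tendsto_zero]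
  refine squeeze_zero (fun _ => dist_nonneg) (fun x => h x y) ?_
  have : Continuous fun x : ι → ℝ => Real.sqrt (∑ i, (x i - y i) ^ 2) := by fun_prop
  simpa using this.tendsto y

lemma LipschitzEuclid.integrable_comp [IsFiniteMeasure μ] (h : LipschitzEuclid ζ)
    {X : Ω → ι → ℝ} (hX : Measurable X) (hXi : ∀ i, Integrable (fun ω => X ω i) μ) :
    Integrable (fun ω => ζ (X ω)) μ := by
  refine Integrable.mono' (g := fun ω => |ζ 0| + ∑ i, |X ω i|)
    ((integrable_const _).add (integrable_finsetSum _ fun i _ => (hXi i).abs))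
    (h.continuous.measurable.comp hX).aestronglyMeasurable (.of_forall fun ω => ?_)
  have h1 := (h (X ω) 0).trans (by simpa using sqrt_sum_sq_le_sum_abs (X ω))
  have h2 := abs_sub_abs_le_abs_sub (ζ (X ω)) (ζ 0)
  rw [Real.norm_eq_abs]
  linarith

lemma bddAbove_d1 [IsFiniteMeasure μ] {X Z : Ω → ι → ℝ} (hX : Measurable X) (hZ : Measurable Z)
    (hXi : ∀ i, Integrable (fun ω => X ω i) μ) (hZi : ∀ i, Integrable (fun ω => Z ω i) μ) :
    BddAbove {r | ∃ ζ : (ι → ℝ) → ℝ, LipschitzEuclid ζ ∧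
      r = |(∫ ω, ζ (X ω) ∂μ) - ∫ ω, ζ (Z ω) ∂μ|} := by
  refine ⟨∫ ω, ∑ i, |X ω i - Z ω i| ∂μ, ?_⟩
  rintro r ⟨ζ, hζ, rfl⟩
  rw [← integral_sub (hζ.integrable_comp hX hXi) (hζ.integrable_comp hZ hZi)]
  refine norm_integral_le_of_norm_le (f := fun ω => ζ (X ω) - ζ (Z ω))
    (integrable_finsetSum _ fun i _ => ((hXi i).sub (hZi i)).abs) (.of_forall fun ω => ?_)
  exact (hζ _ _).trans (sqrt_sum_sq_le_sum_abs fun i => X ω i - Z ω i)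

lemma d1_nonneg (X Z : Ω → ι → ℝ) : 0 ≤ d1 μ X Z :=
  Real.sSup_nonneg (by rintro r ⟨ζ, -, rfl⟩; exact abs_nonneg _)

lemma abs_integral_sub_le_mul_d1 [IsFiniteMeasure μ] {X Z : Ω → ι → ℝ}
    (hX : Measurable X) (hZ : Measurable Z)
    (hXi : ∀ i, Integrable (fun ω => X ω i) μ) (hZi : ∀ i, Integrable (fun ω => Z ω i) μ)
    {L : ℝ} (hL : 0 < L) {f : (ι → ℝ) → ℝ}
    (hf : ∀ x y, |f x - f y| ≤ L * Real.sqrt (∑ i, (x i - y i) ^ 2)) :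
    |(∫ ω, f (X ω) ∂μ) - ∫ ω, f (Z ω) ∂μ| ≤ L * d1 μ X Z := by
  have hlip : LipschitzEuclid fun x => L⁻¹ * f x := fun x y => by
    rw [← mul_sub, abs_mul, abs_of_pos (inv_pos.2 hL), inv_mul_le_iff₀ hL]
    exact hf x y
  have := le_csSup (bddAbove_d1 (μ := μ) hX hZ hXi hZi) ⟨_, hlip, rfl⟩
  rwa [integral_const_mul, integral_const_mul, ← mul_sub, abs_mul, abs_of_pos (inv_pos.2 hL),
    inv_mul_le_iff₀ hL] at this

end LipschitzEuclid

section Moments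

variable {Ω : Type*} [MeasurableSpace Ω] {μ : Measure Ω}

lemma integrable_of_integrable_abs_rpow [IsFiniteMeasure μ] {p : ℝ} (hp : 1 ≤ p) {Y : Ω → ℝ}
    (hY : Measurable Y) (hYi : Integrable (fun ω => |Y ω| ^ p) μ) : Integrable Y μ := by
  refine Integrable.mono' (g := fun ω => 1 + |Y ω| ^ p) ((integrable_const _).add hYi)
    hY.aestronglyMeasurable (.of_forall fun ω => ?_)
  rw [Real.norm_eq_abs]
  rcases le_total |Y ω| 1 with h | h
  · have : 0 ≤ |Y ω| ^ p := by positivity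
    linarith
  · have := Real.self_le_rpow_of_one_le h hp
    linarith

variable {d : ℕ} {q M : ℝ} {X : Ω → Fin d → ℝ}

lemma measurable_prod_clip (hX : Measurable X) : Measurable fun ω => ∏ i, clip M (X ω i) :=
  Finset.measurable_fun_prod _ fun i _ =>
    (continuous_clip M).measurable.comp ((measurable_pi_apply i).comp hX)

lemma integrable_prod_clip [IsFiniteMeasure μ] (hX : Measurable X) (hM : 0 < M) :
    Integrable (fun ω => ∏ i, clip M (X ω i)) μ := by
  refine Integrable.mono' (integrable_const (M ^ d))
    (measurable_prod_clip hX).aestronglyMeasurable (.of_forall fun ω => ?_)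
  simpa [abs_prod] using abs_prod_le_pow_card univ (fun i => clip M (X ω i))
    fun i => abs_clip_le hM.le _

lemma abs_integral_prod_sub_integral_prod_clip_le [IsFiniteMeasure μ] (hX : Measurable X)
    (hq : 0 < q) (hM : 0 < M) (hXi : ∀ i, Integrable (fun ω => |X ω i| ^ (q + d)) μ)
    {C : ℝ} (hC : ∀ i, (∫ ω, |X ω i| ^ (q + d) ∂μ) < C) :
    |(∫ ω, ∏ i, X ω i ∂μ) - ∫ ω, ∏ i, clip M (X ω i) ∂μ| ≤ 2 * M ^ (-q) * (d * C) := by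
  have hdom : Integrable (fun ω => 2 * M ^ (-q) * ∑ i, |X ω i| ^ (q + d)) μ :=
    (integrable_finsetSum _ fun i _ => hXi i).const_mul _
  have hbd : ∀ ω, ‖∏ i, X ω i - ∏ i, clip M (X ω i)‖ ≤
      2 * M ^ (-q) * ∑ i, |X ω i| ^ (q + d) := fun ω => abs_prod_sub_prod_clip_le hq hM (X ω)
  have hmeas : Measurable fun ω => ∏ i, X ω i :=
    Finset.measurable_fun_prod _ fun i _ => (measurable_pi_apply i).comp hX
  have hclip := integrable_prod_clip (μ := μ) hX hM
  have hdiff : Integrable (fun ω => ∏ i, X ω i - ∏ i, clip M (X ω i)) μ :=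
    hdom.mono' (hmeas.sub (measurable_prod_clip hX)).aestronglyMeasurable (.of_forall hbd)
  have hprod : Integrable (fun ω => ∏ i, X ω i) μ :=
    (hdiff.add hclip).congr (.of_forall fun ω => sub_add_cancel _ _)
  rw [← integral_sub hprod hclip]
  refine (norm_integral_le_of_norm_le hdom (.of_forall hbd)).trans ?_
  rw [integral_const_mul, integral_finsetSum _ fun i _ => hXi i]
  gcongr
  calc _ ≤ ∑ _i : Fin d, C := sum_le_sum fun i _ => (hC i).le
    _ = d * C := by simp

end Moments

/-- The choice of truncation level that balances the Lipschitz term and the tail term. -/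
lemma exists_balanced_level {d q C D : ℝ} (hd : 1 ≤ d) (hq : 0 < q) (hC : 0 < C) (hD : 0 < D) :
    ∃ M > 0, Real.sqrt d * M ^ (d - 1) * D + 4 * M ^ (-q) * (d * C) =
      2 * Real.sqrt d * (4 * Real.sqrt d * C) ^ ((d - 1) / (q + d - 1)) *
        D ^ (q / (q + d - 1)) := by
  have hs : 0 < Real.sqrt d := Real.sqrt_pos.2 (by linarith)
  have hss : d = Real.sqrt d * Real.sqrt d := (Real.mul_self_sqrt (by linarith)).symm
  have hr : 0 < q + d - 1 := by linarith
  set B := 4 * Real.sqrt d * C with hB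
  have hB0 : 0 < B := by positivity
  set a := (d - 1) / (q + d - 1) with ha
  set b := q / (q + d - 1) with hb
  have hab : a + b = 1 := by rw [ha, hb]; field_simp; ring
  have hBD : 0 < B / D := by positivity
  refine ⟨(B / D) ^ (1 / (q + d - 1)), by positivity, ?_⟩
  have e1 : ((B / D) ^ (1 / (q + d - 1))) ^ (d - 1) = B ^ a / D ^ a := by
    rw [← Real.rpow_mul hBD.le, one_div_mul_eq_div, Real.div_rpow hB0.le hD.le]
  have e2 : ((B / D) ^ (1 / (q + d - 1))) ^ (-q) = D ^ b / B ^ b := by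
    rw [← Real.rpow_mul hBD.le, one_div_mul_eq_div, neg_div, Real.rpow_neg hBD.le,
      Real.div_rpow hB0.le hD.le, inv_div]
  have e3 : D = D ^ a * D ^ b := by rw [← Real.rpow_add hD, hab, Real.rpow_one]
  have e4 : 4 * (d * C) = Real.sqrt d * (B ^ a * B ^ b) := by
    rw [← Real.rpow_add hB0, hab, Real.rpow_one, hB]
    nth_rewrite 1 [hss]
    ring
  have hDa : 0 < D ^ a := by positivity
  have hBb : 0 < B ^ b := by positivity
  rw [e1, e2]
  calc _ = Real.sqrt d * (B ^ a / D ^ a) * D + D ^ b / B ^ b * (4 * (d * C)) := by ring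
    _ = Real.sqrt d * (B ^ a / D ^ a) * (D ^ a * D ^ b) +
        D ^ b / B ^ b * (Real.sqrt d * (B ^ a * B ^ b)) := by rw [← e3, e4]
    _ = _ := by field_simp; ring

/-- **Moment-product comparison.** If all coordinates of `X` and `Z` have `(q+d)`-th absolute
moments bounded by `C_q`, then the difference of the expectations of the coordinate products
is bounded by `2√d (4√d C_q)^{(d−1)/(q+d−1)} d₁(X,Z)^{q/(q+d−1)}`. -/
theorem stmt5 {Ω : Type*} [MeasurableSpace Ω] (μ : Measure Ω) [IsProbabilityMeasure μ]
    (d : ℕ) (q Cq : ℝ) (hq : 0 < q) (X Z : Ω → Fin d → ℝ)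
    (hX : Measurable X) (hZ : Measurable Z)
    (hXi : ∀ i, Integrable (fun ω => |X ω i| ^ (q + d)) μ)
    (hZi : ∀ i, Integrable (fun ω => |Z ω i| ^ (q + d)) μ)
    (hXm : ∀ i, (∫ ω, |X ω i| ^ (q + d) ∂μ) < Cq)
    (hZm : ∀ i, (∫ ω, |Z ω i| ^ (q + d) ∂μ) < Cq) :
    |(∫ ω, ∏ i, X ω i ∂μ) - ∫ ω, ∏ i, Z ω i ∂μ| ≤
      2 * Real.sqrt d * (4 * Real.sqrt d * Cq) ^ (((d : ℝ) - 1) / (q + d - 1)) *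
        d1 μ X Z ^ (q / (q + d - 1)) := by
  rcases Nat.eq_zero_or_pos d with rfl | hd
  · simp
  have hd1 : (1 : ℝ) ≤ d := by exact_mod_cast hd
  have hC : 0 < Cq :=
    (integral_nonneg fun ω => by positivity).trans_lt (hXm ⟨0, hd⟩)
  have hXint : ∀ i, Integrable (fun ω => X ω i) μ := fun i =>
    integrable_of_integrable_abs_rpow (by linarith) ((measurable_pi_apply i).comp hX) (hXi i)
  have hZint : ∀ i, Integrable (fun ω => Z ω i) μ := fun i =>
    integrable_of_integrable_abs_rpow (by linarith) ((measurable_pi_apply i).comp hZ) (hZi i)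
  have hlarger : ∀ D, d1 μ X Z < D → |(∫ ω, ∏ i, X ω i ∂μ) - ∫ ω, ∏ i, Z ω i ∂μ| ≤
      2 * Real.sqrt d * (4 * Real.sqrt d * Cq) ^ (((d : ℝ) - 1) / (q + d - 1)) *
        D ^ (q / (q + d - 1)) := by
    intro D hD
    obtain ⟨M, hM, hbal⟩ := exists_balanced_level hd1 hq hC ((d1_nonneg X Z).trans_lt hD)
    have hL : 0 < Real.sqrt d * M ^ ((d : ℝ) - 1) := by positivity
    have hmid := (abs_integral_sub_le_mul_d1 (μ := μ) hX hZ hXint hZint hL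
      (f := fun x => ∏ i, clip M (x i)) (abs_prod_clip_sub_le hM)).trans
        (mul_le_mul_of_nonneg_left hD.le hL.le)
    have hXt := abs_integral_prod_sub_integral_prod_clip_le hX hq hM hXi hXm
    have hZt := abs_integral_prod_sub_integral_prod_clip_le hZ hq hM hZi hZm
    rw [abs_le] at hmid hXt hZt ⊢
    constructor <;> linarith
  have hcont : Continuous fun D : ℝ =>
      2 * Real.sqrt d * (4 * Real.sqrt d * Cq) ^ (((d : ℝ) - 1) / (q + d - 1)) *
        D ^ (q / (q + d - 1)) :=
    continuous_const.mul (Real.continuous_rpow_const (div_nonneg hq.le (by linarith)))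
  exact ge_of_tendsto (hcont.continuousWithinAt (s := Set.Ioi (d1 μ X Z)))
    (eventually_mem_nhdsWithin.mono hlarger)

end
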